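/- Let n ≥ 1 and write Φ_n^*(X) = ∑_{i=0}^{φ*(n)} a_i X^i for its coefficients. Then for every k with 1 ≤ k ≤ φ*(n), k · a_k = −μ*(n) · ∑_{j=1}^k a_{k−j} · μ*((j,n)_*) · φ*((j,n)_*), where μ*(m) = (−1)^{ω(m)} with ω(m) the number of distinct prime factors of m, and φ*(m) = #{1 ≤ j ≤ m : (j,m)_* = 1} is the unitary Euler function. -/

import Mathlib

open Complex Polynomial Finset

/-- The unitary gcd `(j,n)_*`: the largest `d` with `d ∣ j`, `d ∣ n` and `gcd(d, n/d) = 1`. -/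
def ugcd (j n : ℕ) : ℕ :=
  Nat.findGreatest (fun d => d ∣ j ∧ d ∣ n ∧ Nat.gcd d (n / d) = 1) n

/-- The unitary cyclotomic polynomial `Φ_n^*(X) = ∏_{1 ≤ j ≤ n, (j,n)_* = 1} (X − ζ_n^j)`. -/
noncomputable def unitaryCyc (n : ℕ) : Polynomial ℂ :=
  ∏ j ∈ (Finset.Icc 1 n).filter (fun j => ugcd j n = 1),
    (X - C (Complex.exp (2 * Real.pi * Complex.I / n) ^ j))

/-- The unitary Möbius function `μ*(m) = (−1)^{ω(m)}`, with `ω(m)` the number of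
distinct prime factors of `m`. -/
def umu (m : ℕ) : ℤ := (-1) ^ m.primeFactors.card

/-- The unitary Euler function `φ*(m) = #{1 ≤ j ≤ m : (j,m)_* = 1}`. -/
def uphi (m : ℕ) : ℕ := ((Finset.Icc 1 m).filter (fun j => ugcd j m = 1)).card

/-- Product of the full prime powers of `n` over `S`. -/
def uq (n : ℕ) (S : Finset ℕ) : ℕ := ∏ p ∈ S, p ^ n.factorization p

/-- The primes whose full power in `n` divides `j`. -/
def uT (n j : ℕ) : Finset ℕ := n.primeFactors.filter (fun p => p ^ n.factorization p ∣ j)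

lemma newton_aux (P Q : ℂ[X]) (r : ℂ) (hr : r ≠ 0) (h : P = (X - C r) * Q) (k : ℕ) :
    Q.coeff k = -∑ j ∈ Finset.range (k+1), P.coeff (k - j) * r⁻¹ ^ (j+1) := by
  induction k with
  | zero =>
    simp [h, mul_coeff_zero]
    field_simp
  | succ k ih =>
    rw [Finset.sum_range_succ']
    have e : ∑ j ∈ Finset.range (k+1), P.coeff (k + 1 - (j+1)) * r⁻¹ ^ (j+1+1)
        = r⁻¹ * ∑ j ∈ Finset.range (k+1), P.coeff (k - j) * r⁻¹ ^ (j+1) := by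
      rw [Finset.mul_sum]
      refine Finset.sum_congr rfl fun j _ => ?_
      rw [Nat.add_sub_add_right]; ring
    have e2 : P.coeff (k+1) = Q.coeff k - r * Q.coeff (k+1) := by
      rw [h, sub_mul, coeff_sub, coeff_X_mul, coeff_C_mul]
    rw [e, Nat.sub_zero, e2]
    have : ∑ j ∈ Finset.range (k+1), P.coeff (k - j) * r⁻¹ ^ (j+1) = - Q.coeff k := by
      rw [ih]; ring
    rw [this]
    have hh : r * r⁻¹ = 1 := mul_inv_cancel₀ hr
    linear_combination (-Q.coeff (k+1)) * hh

lemma newton (s : Finset ℕ) (r : ℕ → ℂ) (hr : ∀ i ∈ s, r i ≠ 0) (k : ℕ) (hk : 1 ≤ k) :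
    (k : ℂ) * (∏ i ∈ s, (X - C (r i))).coeff k =
      -∑ j ∈ Finset.Icc 1 k, (∏ i ∈ s, (X - C (r i))).coeff (k - j) * ∑ i ∈ s, ((r i)⁻¹) ^ j := by
  obtain ⟨k, rfl⟩ : ∃ l, k = l + 1 := ⟨k - 1, by omega⟩
  have h2 : ∀ i ∈ s, (∏ j ∈ s.erase i, (X - C (r j))).coeff k =
      -∑ j ∈ Finset.range (k+1), (∏ i ∈ s, (X - C (r i))).coeff (k - j) * (r i)⁻¹ ^ (j+1) :=
    fun i hi => newton_aux _ _ _ (hr i hi) (Finset.mul_prod_erase s (fun i => X - C (r i)) hi).symm k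
  have h3 : derivative (∏ i ∈ s, (X - C (r i))) = ∑ i ∈ s, ∏ j ∈ s.erase i, (X - C (r j)) := by
    rw [derivative_prod_finset]
    exact Finset.sum_congr rfl fun i _ => by simp
  generalize (∏ i ∈ s, (X - C (r i))) = P at *
  have h1 : ((k+1 : ℕ) : ℂ) * P.coeff (k+1) = (derivative P).coeff k := by
    rw [coeff_derivative]; push_cast; ring
  rw [h1, h3, finsetSum_coeff, Finset.sum_congr rfl h2, Finset.sum_neg_distrib, Finset.sum_comm,
    ← Finset.Ico_add_one_right_eq_Icc, Finset.sum_Ico_eq_sum_range]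
  simp only [Nat.add_sub_cancel]
  refine congrArg Neg.neg (Finset.sum_congr rfl fun j _ => ?_)
  rw [Finset.mul_sum]
  refine Finset.sum_congr rfl fun i _ => ?_
  rw [Nat.add_comm 1 j, Nat.add_sub_add_right]

lemma uq_compl (n : ℕ) (hn : n ≠ 0) (S : Finset ℕ) (hS : S ⊆ n.primeFactors) :
    uq n (n.primeFactors \ S) * uq n S = n := by
  unfold uq
  rw [Finset.prod_sdiff hS]
  exact Nat.prod_factorization_pow_eq_self hn

lemma uq_coprime (n : ℕ) (S T : Finset ℕ) (hS : S ⊆ n.primeFactors) (hT : T ⊆ n.primeFactors)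
    (h : Disjoint S T) : Nat.Coprime (uq n S) (uq n T) := by
  unfold uq
  refine Nat.Coprime.prod_left fun p hp => Nat.Coprime.prod_right fun q hq => ?_
  refine Nat.Coprime.pow _ _ ?_
  refine (Nat.coprime_primes (Nat.prime_of_mem_primeFactors (hS hp))
    (Nat.prime_of_mem_primeFactors (hT hq))).2 ?_
  rintro rfl
  exact Finset.disjoint_left.1 h hp hq

lemma uq_dvd_iff (n j : ℕ) (S : Finset ℕ) (hS : S ⊆ n.primeFactors) :
    uq n S ∣ j ↔ S ⊆ uT n j := by
  constructor
  · intro h p hp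
    exact Finset.mem_filter.2 ⟨hS hp, (Finset.dvd_prod_of_mem _ hp).trans h⟩
  · intro h
    unfold uq
    refine Finset.prod_dvd_of_isRelPrime ?_ fun p hp => (Finset.mem_filter.1 (h hp)).2
    intro p hp q hq hpq
    refine Nat.coprime_iff_isRelPrime.1 (Nat.Coprime.pow _ _ ?_)
    exact (Nat.coprime_primes (Nat.prime_of_mem_primeFactors (hS hp))
      (Nat.prime_of_mem_primeFactors (hS hq))).2 hpq

lemma uT_sub (n j : ℕ) : uT n j ⊆ n.primeFactors := Finset.filter_subset _ _

lemma uq_pos (n : ℕ) (S : Finset ℕ) (hS : S ⊆ n.primeFactors) : 0 < uq n S :=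
  Finset.prod_pos fun p hp => pow_pos (Nat.prime_of_mem_primeFactors (hS hp)).pos _

lemma unitary_dvd (n d : ℕ) (hn : n ≠ 0) (hd : d ∣ n) (hc : Nat.gcd d (n / d) = 1) (p : ℕ)
    (hp : p ∈ d.primeFactors) : d.factorization p = n.factorization p := by
  obtain ⟨e, rfl⟩ := hd
  have hd0 : d ≠ 0 := left_ne_zero_of_mul hn
  rw [Nat.mul_div_cancel_left _ (Nat.pos_of_ne_zero hd0)] at hc
  have hpp := Nat.prime_of_mem_primeFactors hp
  have : ¬ p ∣ e := fun h => hpp.one_lt.ne' (Nat.dvd_one.1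
    (hc ▸ Nat.dvd_gcd (Nat.dvd_of_mem_primeFactors hp) h))
  rw [Nat.factorization_mul hd0 (right_ne_zero_of_mul hn)]
  simp [Nat.factorization_eq_zero_of_not_dvd this]

lemma ugcd_eq (n j : ℕ) (hn : n ≠ 0) : ugcd j n = uq n (uT n j) := by
  have hmul := uq_compl n hn _ (uT_sub n j)
  have hpos := uq_pos n _ (uT_sub n j)
  have hdvd : uq n (uT n j) ∣ n := ⟨_, by rw [mul_comm]; exact hmul.symm⟩
  unfold ugcd
  rw [Nat.findGreatest_eq_iff]
  refine ⟨Nat.le_of_dvd (Nat.pos_of_ne_zero hn) hdvd, fun _ => ⟨?_, hdvd, ?_⟩, ?_⟩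
  · exact (uq_dvd_iff n j _ (uT_sub n j)).2 subset_rfl
  · have : n / uq n (uT n j) = uq n (n.primeFactors \ uT n j) :=
      Nat.div_eq_of_eq_mul_left hpos hmul.symm
    rw [this]
    exact uq_coprime n _ _ (uT_sub n j) Finset.sdiff_subset Finset.disjoint_sdiff
  · rintro d hd _ ⟨h1, h2, h3⟩
    refine absurd (Nat.le_of_dvd hpos ?_) (not_le.2 hd)
    have hd0 : d ≠ 0 := fun h => hn (by simpa [h] using h2)
    have e : d = uq n d.primeFactors := by
      conv_lhs => rw [← Nat.prod_factorization_pow_eq_self hd0]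
      exact Finset.prod_congr rfl fun p hp => by rw [unitary_dvd n d hn h2 h3 p hp]
    have hs : d.primeFactors ⊆ n.primeFactors := Nat.primeFactors_mono h2 hn
    have : d.primeFactors ⊆ uT n j := (uq_dvd_iff n j _ hs).1 (e ▸ h1)
    rw [e]
    exact Finset.prod_dvd_prod_of_subset _ _ _ this

lemma fact_pos (n p : ℕ) (hp : p ∈ n.primeFactors) : n.factorization p ≠ 0 := by
  rw [← Nat.support_factorization] at hp
  exact Finsupp.mem_support_iff.1 hp

lemma primeFactors_uq (n : ℕ) (S : Finset ℕ) (hS : S ⊆ n.primeFactors) :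
    (uq n S).primeFactors = S := by
  ext p
  rw [Nat.mem_primeFactors]
  constructor
  · rintro ⟨hp, hd, _⟩
    obtain ⟨q, hq, h⟩ := (Prime.dvd_finsetProd_iff hp.prime _).1 hd
    have := (Nat.prime_dvd_prime_iff_eq hp (Nat.prime_of_mem_primeFactors (hS hq))).1
      (hp.dvd_of_dvd_pow h)
    exact this ▸ hq
  · intro h
    refine ⟨Nat.prime_of_mem_primeFactors (hS h), ?_, (uq_pos n S hS).ne'⟩
    exact (dvd_pow_self p (fact_pos n p (hS h))).trans (Finset.dvd_prod_of_mem _ h)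

lemma fact_uq (n : ℕ) (hn : n ≠ 0) (S : Finset ℕ) (hS : S ⊆ n.primeFactors) (p : ℕ) (hp : p ∈ S) :
    (uq n S).factorization p = n.factorization p := by
  have hmul := uq_compl n hn S hS
  have hpos := uq_pos n S hS
  refine unitary_dvd n _ hn ⟨_, by rw [mul_comm]; exact hmul.symm⟩ ?_ p
    (by rwa [primeFactors_uq n S hS])
  rw [Nat.div_eq_of_eq_mul_left hpos hmul.symm]
  exact uq_coprime n _ _ hS Finset.sdiff_subset Finset.disjoint_sdiff

lemma ugcd_one_iff (n j : ℕ) (hn : n ≠ 0) : ugcd j n = 1 ↔ uT n j = ∅ := by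
  rw [ugcd_eq n j hn]
  constructor
  · intro h
    rw [← primeFactors_uq n _ (uT_sub n j), h, Nat.primeFactors_one]
  · intro h; rw [h]; rfl

lemma indicator (n j : ℕ) (hn : n ≠ 0) : (if ugcd j n = 1 then (1:ℂ) else 0) =
    ∑ S ∈ n.primeFactors.powerset, (-1) ^ S.card * (if uq n S ∣ j then 1 else 0) := by
  have e : ∑ S ∈ n.primeFactors.powerset, (-1 : ℂ) ^ S.card * (if uq n S ∣ j then 1 else 0)
      = ∑ S ∈ (uT n j).powerset, (-1 : ℂ) ^ S.card := by
    simp only [mul_ite, mul_one, mul_zero]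
    rw [← Finset.sum_filter]
    refine Finset.sum_congr ?_ fun _ _ => rfl
    ext S
    simp only [Finset.mem_filter, Finset.mem_powerset]
    constructor
    · rintro ⟨h1, h2⟩; exact (uq_dvd_iff n j S h1).1 h2
    · intro h
      exact ⟨h.trans (uT_sub n j), (uq_dvd_iff n j S (h.trans (uT_sub n j))).2 h⟩
  rw [e, if_congr (ugcd_one_iff n j hn) rfl rfl]
  have := Finset.sum_powerset_neg_one_pow_card (x := uT n j)
  exact_mod_cast congrArg (Int.cast : ℤ → ℂ) this.symm

lemma geom (e : ℕ) (w : ℂ) (hw : w ^ e = 1) :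
    ∑ i ∈ Finset.Icc 1 e, w ^ i = if w = 1 then (e : ℂ) else 0 := by
  split_ifs with h
  · simp [h]
  · rw [← Finset.Ico_add_one_right_eq_Icc, Finset.sum_Ico_eq_sum_range]
    simp only [Nat.add_sub_cancel, pow_add, ← Finset.mul_sum]
    rw [geom_sum_eq h, hw]; simp

lemma inner_sum_eq (n d e m : ℕ) (hn : n ≠ 0) (h : e * d = n) (z : ℂ) (hz : IsPrimitiveRoot z n) :
    ∑ j ∈ Finset.Icc 1 n, (if d ∣ j then (1:ℂ) else 0) * ((z ^ j)⁻¹) ^ m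
      = if e ∣ m then (e : ℂ) else 0 := by
  have hd : d ≠ 0 := by rintro rfl; simp at h; exact hn h.symm
  have hi := hz.inv
  have h1 : ((z⁻¹ ^ m) ^ d) ^ e = 1 := by
    rw [← pow_mul, ← pow_mul, hi.pow_eq_one_iff_dvd]
    exact ⟨m, by rw [← h]; ring⟩
  have h2 : (z⁻¹ ^ m) ^ d = 1 ↔ e ∣ m := by
    rw [← pow_mul, hi.pow_eq_one_iff_dvd, ← h]
    exact Nat.mul_dvd_mul_iff_right (Nat.pos_of_ne_zero hd)
  rw [← if_congr h2 rfl rfl, ← geom e _ h1]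
  simp only [ite_mul, one_mul, zero_mul]
  rw [← Finset.sum_filter]
  symm
  refine Finset.sum_bij (fun i _ => d * i) ?_ ?_ ?_ ?_
  · intro i hi
    simp only [Finset.mem_Icc, Finset.mem_filter] at hi ⊢
    refine ⟨⟨Nat.mul_pos (Nat.pos_of_ne_zero hd) hi.1, ?_⟩, dvd_mul_right _ _⟩
    rw [← h, mul_comm e]; exact Nat.mul_le_mul_left _ hi.2
  · intro a _ b _ hab
    exact Nat.eq_of_mul_eq_mul_left (Nat.pos_of_ne_zero hd) hab
  · intro j hj
    simp only [Finset.mem_Icc, Finset.mem_filter] at hj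
    obtain ⟨⟨h3, h4⟩, i, rfl⟩ := hj
    refine ⟨i, Finset.mem_Icc.2 ⟨Nat.pos_of_mul_pos_left h3, ?_⟩, rfl⟩
    rw [← h, mul_comm e] at h4
    exact Nat.le_of_mul_le_mul_left h4 (Nat.pos_of_ne_zero hd)
  · intro i _
    rw [← inv_pow, ← pow_mul, ← pow_mul, ← pow_mul]; congr 1; ring

lemma psum (n m : ℕ) (hn : n ≠ 0) (z : ℂ) (hz : IsPrimitiveRoot z n) :
    ∑ j ∈ (Finset.Icc 1 n).filter (fun j => ugcd j n = 1), ((z ^ j)⁻¹) ^ m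
      = (umu n : ℂ) * ∏ p ∈ uT n m, (1 - (p : ℂ) ^ n.factorization p) := by
  have e1 : ∀ j, (if ugcd j n = 1 then ((z ^ j)⁻¹) ^ m else 0) =
      ∑ S ∈ n.primeFactors.powerset, (-1 : ℂ) ^ S.card *
        ((if uq n S ∣ j then 1 else 0) * ((z ^ j)⁻¹) ^ m) := by
    intro j
    have := congrArg (· * ((z ^ j)⁻¹) ^ m) (indicator n j hn)
    simp only [ite_mul, one_mul, zero_mul, Finset.sum_mul, mul_assoc] at this ⊢
    exact this
  rw [Finset.sum_filter, Finset.sum_congr rfl fun j _ => e1 j, Finset.sum_comm]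
  simp only [← Finset.mul_sum]
  have e2 : ∀ S ∈ n.primeFactors.powerset, (-1 : ℂ) ^ S.card *
      ∑ j ∈ Finset.Icc 1 n, (if uq n S ∣ j then (1:ℂ) else 0) * ((z ^ j)⁻¹) ^ m
      = (umu n : ℂ) * ((-1) ^ (n.primeFactors \ S).card *
        if uq n (n.primeFactors \ S) ∣ m then (uq n (n.primeFactors \ S) : ℂ) else 0) := by
    intro S hS
    rw [Finset.mem_powerset] at hS
    rw [inner_sum_eq n _ _ m hn (uq_compl n hn S hS) z hz, ← mul_assoc]
    congr 1
    unfold umu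
    have := Finset.card_sdiff_add_card_eq_card hS
    push_cast
    rw [← this, pow_add, mul_right_comm, ← mul_pow]; simp
  rw [Finset.sum_congr rfl e2, ← Finset.mul_sum]
  congr 1
  have e3 : ∑ S ∈ n.primeFactors.powerset, ((-1 : ℂ) ^ (n.primeFactors \ S).card *
        if uq n (n.primeFactors \ S) ∣ m then (uq n (n.primeFactors \ S) : ℂ) else 0)
      = ∑ S ∈ n.primeFactors.powerset, ((-1 : ℂ) ^ S.card *
        if uq n S ∣ m then (uq n S : ℂ) else 0) := by
    refine Finset.sum_nbij' (fun S => n.primeFactors \ S) (fun S => n.primeFactors \ S)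
      ?_ ?_ ?_ ?_ ?_
    · intro S _; exact Finset.mem_powerset.2 Finset.sdiff_subset
    · intro S _; exact Finset.mem_powerset.2 Finset.sdiff_subset
    · intro S hS; exact Finset.sdiff_sdiff_eq_self (Finset.mem_powerset.1 hS)
    · intro S hS; exact Finset.sdiff_sdiff_eq_self (Finset.mem_powerset.1 hS)
    · intro S _; rfl
  have e4 : ∏ p ∈ uT n m, (1 - (p : ℂ) ^ n.factorization p) =
      ∑ S ∈ (uT n m).powerset, (-1 : ℂ) ^ S.card * (uq n S : ℂ) := by
    simp only [sub_eq_add_neg]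
    rw [Finset.prod_one_add]
    refine Finset.sum_congr rfl fun S _ => ?_
    rw [Finset.prod_neg, uq]; push_cast; rfl
  rw [e3, e4]
  simp only [mul_ite, mul_zero]
  rw [← Finset.sum_filter]
  refine Finset.sum_congr ?_ fun S _ => rfl
  ext S
  simp only [Finset.mem_filter, Finset.mem_powerset]
  constructor
  · rintro ⟨h1, h2⟩; exact (uq_dvd_iff n m S h1).1 h2
  · intro h
    exact ⟨h.trans (uT_sub n m), (uq_dvd_iff n m S (h.trans (uT_sub n m))).2 h⟩

lemma umu_sq (n : ℕ) : (umu n : ℂ) * umu n = 1 := by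
  unfold umu; push_cast; rw [← mul_pow]; simp

lemma uphi_eq (n : ℕ) (hn : n ≠ 0) :
    (uphi n : ℂ) = (umu n : ℂ) * ∏ p ∈ n.primeFactors, (1 - (p : ℂ) ^ n.factorization p) := by
  have := psum n 0 hn _ (Complex.isPrimitiveRoot_exp n hn)
  simpa [uT, uphi] using this

lemma final (n m : ℕ) (hn : n ≠ 0) : (umu (ugcd m n) : ℂ) * (uphi (ugcd m n) : ℂ) =
    ∏ p ∈ uT n m, (1 - (p : ℂ) ^ n.factorization p) := by
  rw [ugcd_eq n m hn, uphi_eq _ (uq_pos n _ (uT_sub n m)).ne', ← mul_assoc, umu_sq, one_mul,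
    primeFactors_uq n _ (uT_sub n m)]
  exact Finset.prod_congr rfl fun p hp => by rw [fact_uq n hn _ (uT_sub n m) p hp]

theorem stmt19 (n : ℕ) (hn : 1 ≤ n) :
    ∀ k : ℕ, 1 ≤ k → k ≤ uphi n →
      (k : ℂ) * (unitaryCyc n).coeff k =
        -(umu n : ℂ) * ∑ j ∈ Finset.Icc 1 k,
          (unitaryCyc n).coeff (k - j) * (umu (ugcd j n) : ℂ) * (uphi (ugcd j n) : ℂ) := by
  intro k hk _
  have hn0 : n ≠ 0 := by omega
  have hN := newton ((Finset.Icc 1 n).filter (fun j => ugcd j n = 1))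
    (fun j => Complex.exp (2 * Real.pi * Complex.I / n) ^ j)
    (fun i _ => pow_ne_zero _ (Complex.exp_ne_zero _)) k hk
  unfold unitaryCyc
  rw [hN, neg_mul, Finset.mul_sum]
  congr 1
  refine Finset.sum_congr rfl fun j _ => ?_
  rw [psum n j hn0 _ (Complex.isPrimitiveRoot_exp n hn0), ← final n j hn0]
  ring
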